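/- arXiv:1703.06178 — 2 statements merged into one kernel-verified Lean document; each statement's English description precedes it below -/
import Mathlib

section
/- With Φ the fundamental solution as above, suppose there exists x > a with φ₁₂(a,x) = 0, and let b = min{x > a : φ₁₂(a,x) = 0}. Then φ₁₁(a,b) < 0 and φ₂₂(a,b) < 0. -/
open MeasureTheory Set

/-- A continuous function on a compact interval whose bounds `M` all improve to `K + M / 2`
is bounded by `2 * K`. -/
lemma le_two_mul_of_forall_bound_improves {N : ℝ → ℝ} {t s K : ℝ}
    (hN : ContinuousOn N (Icc t s))
    (himp : ∀ M, (∀ z ∈ Icc t s, N z ≤ M) → ∀ x ∈ Icc t s, N x ≤ K + M / 2) :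
    ∀ x ∈ Icc t s, N x ≤ 2 * K := by
  intro x hx
  obtain ⟨x₀, hx₀, hmax⟩ := isCompact_Icc.exists_isMaxOn ⟨x, hx⟩ hN
  have h₀ := himp (N x₀) (fun z hz => hmax hz) x₀ hx₀
  have h₁ : N x ≤ N x₀ := hmax hx
  linarith

/-- The integral of an integrable function over `[t, c]` is small for `t < c` close to `c`. -/
lemma exists_Ico_integral_le_half {w : ℝ → ℝ} {a c : ℝ} (hac : a < c)
    (hw : IntervalIntegrable w volume a c) :
    ∃ t ∈ Ico a c, ∫ z in t..c, w z ≤ 1 / 2 := by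
  have hcont : ContinuousOn (fun x => ∫ z in x..c, w z) (uIcc a c) := by
    apply intervalIntegral.continuousOn_primitive_interval_left
    rw [uIcc_of_le hac.le]
    exact (intervalIntegrable_iff_integrableOn_Icc_of_le hac.le).1 hw
  rw [uIcc_of_le hac.le] at hcont
  have htend := (hcont c (right_mem_Icc.2 hac.le)).mono Ico_subset_Icc_self
  have hlt : ∀ᶠ x in nhdsWithin c (Ico a c), ∫ z in x..c, w z < 1 / 2 :=
    htend.eventually_lt_const (by simp)
  have : (nhdsWithin c (Ico a c)).NeBot := by
    rw [nhdsWithin_Ico_eq_nhdsLT hac]; infer_instance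
  obtain ⟨t, ht, htm⟩ := (hlt.and self_mem_nhdsWithin).exists
  exact ⟨t, htm, ht.le⟩

lemma continuousOn_Icc_of_eq_const_add_integral {f g : ℝ → ℝ} {k a b : ℝ} (hab : a ≤ b)
    (hg : IntervalIntegrable g volume a b)
    (hf : ∀ y ∈ Icc a b, f y = k + ∫ z in a..y, g z) : ContinuousOn f (Icc a b) := by
  have h := intervalIntegral.continuousOn_primitive_interval' hg left_mem_uIcc
  rw [uIcc_of_le hab] at h
  exact (continuousOn_const.add h).congr hf

/-- Increments of a primitive are bounded by the integral of a majorant. -/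
lemma abs_sub_le_integral_of_eq_const_add_integral {f g h : ℝ → ℝ} {k a b t s : ℝ}
    (hat : a ≤ t) (hts : t ≤ s) (hsb : s ≤ b)
    (hg : IntervalIntegrable g volume a b)
    (hf : ∀ y ∈ Icc a b, f y = k + ∫ z in a..y, g z)
    (hh : IntervalIntegrable h volume t s)
    (hgh : ∀ z ∈ Icc t s, |g z| ≤ h z) : |f s - f t| ≤ ∫ z in t..s, h z := by
  have has : a ≤ s := hat.trans hts
  have hab : a ≤ b := has.trans hsb
  have hgs : IntervalIntegrable g volume a s := hg.mono_set (by
    rw [uIcc_of_le hab, uIcc_of_le has]; exact Icc_subset_Icc_right hsb)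
  have hgt : IntervalIntegrable g volume a t := hg.mono_set (by
    rw [uIcc_of_le hab, uIcc_of_le hat]; exact Icc_subset_Icc_right (hts.trans hsb))
  have heq : f s - f t = ∫ z in t..s, g z := by
    rw [hf s ⟨has, hsb⟩, hf t ⟨hat, hts.trans hsb⟩,
      ← intervalIntegral.integral_interval_sub_left hgs hgt]
    ring
  rw [heq, ← Real.norm_eq_abs]
  exact intervalIntegral.norm_integral_le_of_norm_le hts
    (Filter.Eventually.of_forall fun z hz => hgh z (Ioc_subset_Icc_self hz)) hh

/-- A local solution on `[a, s]` of the planar linear system grows by at most a factor of two over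
an interval on which the coefficients have small integral. -/
lemma abs_add_abs_le_of_linear_system {p q u v : ℝ → ℝ} {k₁ k₂ a t s : ℝ}
    (hat : a ≤ t) (hts : t ≤ s)
    (hp : IntervalIntegrable p volume a s) (hq : IntervalIntegrable q volume a s)
    (huc : ContinuousOn u (Icc a s)) (hvc : ContinuousOn v (Icc a s))
    (hu : ∀ y ∈ Icc a s, u y = k₁ + ∫ z in a..y, v z)
    (hv : ∀ y ∈ Icc a s, v y = k₂ + ∫ z in a..y, (p z * u z - q z * v z))
    (hsmall : ∫ z in t..s, (1 + |p z| + |q z|) ≤ 1 / 2) :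
    |u s| + |v s| ≤ 2 * (|u t| + |v t|) := by
  have has : a ≤ s := hat.trans hts
  have huI := uIcc_of_le has
  have hvi : IntervalIntegrable v volume a s := (huI ▸ hvc).intervalIntegrable
  have hfi : IntervalIntegrable (fun z => p z * u z - q z * v z) volume a s :=
    (hp.mul_continuousOn (huI ▸ huc)).sub (hq.mul_continuousOn (huI ▸ hvc))
  have hsub : Icc t s ⊆ Icc a s := Icc_subset_Icc_left hat
  have hw : IntervalIntegrable (fun z => 1 + |p z| + |q z|) volume a s :=
    (intervalIntegrable_const.add hp.abs).add hq.abs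
  refine le_two_mul_of_forall_bound_improves (N := fun z => |u z| + |v z|)
    ((huc.mono hsub).abs.add (hvc.mono hsub).abs) (fun M hM x hx => ?_) s (right_mem_Icc.2 hts)
  have hM0 : 0 ≤ M := (by positivity : 0 ≤ |u x| + |v x|).trans (hM x hx)
  have hmono : ∀ {g : ℝ → ℝ}, IntervalIntegrable g volume a s →
      IntervalIntegrable g volume t x := fun hg => hg.mono_set (by
    rw [huI, uIcc_of_le hx.1]; exact Icc_subset_Icc hat hx.2)
  have hMv : ∀ z ∈ Icc t x, |u z| ≤ M ∧ |v z| ≤ M := fun z hz => by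
    have := hM z ⟨hz.1, hz.2.trans hx.2⟩
    constructor <;> linarith [abs_nonneg (u z), abs_nonneg (v z)]
  have i₁ : IntervalIntegrable (fun _ : ℝ => M) volume t x := intervalIntegrable_const
  have i₂ : IntervalIntegrable (fun z => M * (|p z| + |q z|)) volume t x :=
    hmono ((hp.abs.add hq.abs).const_mul M)
  have h₁ := abs_sub_le_integral_of_eq_const_add_integral hat hx.1 hx.2 hvi hu i₁
    (fun z hz => (hMv z hz).2)
  have h₂ := abs_sub_le_integral_of_eq_const_add_integral hat hx.1 hx.2 hfi hv i₂
    (fun z hz => by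
      calc |p z * u z - q z * v z| ≤ |p z * u z| + |q z * v z| := abs_sub _ _
        _ = |p z| * |u z| + |q z| * |v z| := by rw [abs_mul, abs_mul]
        _ ≤ |p z| * M + |q z| * M := by
            gcongr
            exacts [(hMv z hz).1, (hMv z hz).2]
        _ = M * (|p z| + |q z|) := by ring)
  have h₃ : (∫ _ in t..x, M) + ∫ z in t..x, M * (|p z| + |q z|) =
      M * ∫ z in t..x, (1 + |p z| + |q z|) := by
    rw [← intervalIntegral.integral_add i₁ i₂, ← intervalIntegral.integral_const_mul]
    congr 1; ext z; ring
  have h₄ : ∫ z in t..x, (1 + |p z| + |q z|) ≤ ∫ z in t..s, (1 + |p z| + |q z|) :=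
    intervalIntegral.integral_mono_interval le_rfl hx.1 hx.2
      (Filter.Eventually.of_forall fun z => by positivity)
      (hw.mono_set (by rw [huI, uIcc_of_le hts]; exact hsub))
  have h₅ := mul_le_mul_of_nonneg_left (h₄.trans hsmall) hM0
  have h₆ := abs_sub_abs_le_abs_sub (u x) (u t)
  have h₇ := abs_sub_abs_le_abs_sub (v x) (v t)
  linarith

/-- If the integral equations of a planar linear system with integrable coefficients hold on
`[a, b]`, then the right-hand side is integrable there, so that the integrals are genuine. -/
lemma intervalIntegrable_of_linear_system {p q u v : ℝ → ℝ} {k₁ k₂ a b : ℝ} (hab : a ≤ b)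
    (hp : IntervalIntegrable p volume a b) (hq : IntervalIntegrable q volume a b)
    (hu : ∀ y ∈ Icc a b, u y = k₁ + ∫ z in a..y, v z)
    (hv : ∀ y ∈ Icc a b, v y = k₂ + ∫ z in a..y, (p z * u z - q z * v z)) :
    IntervalIntegrable (fun z => p z * u z - q z * v z) volume a b := by
  set f : ℝ → ℝ := fun z => p z * u z - q z * v z with hf
  set S : Set ℝ := {y | y ∈ Icc a b ∧ IntervalIntegrable f volume a y} with hS
  have haS : a ∈ S := ⟨left_mem_Icc.2 hab, IntervalIntegrable.refl⟩
  have hSb : BddAbove S := ⟨b, fun y hy => hy.1.2⟩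
  set c := sSup S with hc
  have hac : a ≤ c := le_csSup hSb haS
  have hcb : c ≤ b := csSup_le ⟨a, haS⟩ fun y hy => hy.1.2
  have hmono : ∀ {g : ℝ → ℝ} {x y : ℝ}, IntervalIntegrable g volume a b → a ≤ x → x ≤ y →
      y ≤ b → IntervalIntegrable g volume x y := fun hg hx hxy hy => hg.mono_set (by
    rw [uIcc_of_le hab, uIcc_of_le hxy]; exact Icc_subset_Icc hx hy)
  have hlt : ∀ y ∈ Ico a c, ContinuousOn u (Icc a y) ∧ ContinuousOn v (Icc a y) := by
    intro y hy
    obtain ⟨y', hy', hyy'⟩ := exists_lt_of_lt_csSup ⟨a, haS⟩ hy.2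
    have hfy : IntervalIntegrable f volume a y := hy'.2.mono_set (by
      rw [uIcc_of_le hy.1, uIcc_of_le hy'.1.1]; exact Icc_subset_Icc_right hyy'.le)
    have hsub : Icc a y ⊆ Icc a b := Icc_subset_Icc_right (hy.2.le.trans hcb)
    have hvc : ContinuousOn v (Icc a y) :=
      continuousOn_Icc_of_eq_const_add_integral hy.1 hfy fun z hz => hv z (hsub hz)
    have hvi : IntervalIntegrable v volume a y :=
      (uIcc_of_le hy.1 ▸ hvc : ContinuousOn v (uIcc a y)).intervalIntegrable
    exact ⟨continuousOn_Icc_of_eq_const_add_integral hy.1 hvi fun z hz => hu z (hsub hz), hvc⟩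
  have hgt : ∀ y ∈ Ioc c b, v y = k₂ := by
    intro y hy
    have hyS : ¬ IntervalIntegrable f volume a y := fun h =>
      (le_csSup hSb ⟨⟨hac.trans hy.1.le, hy.2⟩, h⟩ : y ≤ c).not_gt hy.1
    rw [hv y ⟨hac.trans hy.1.le, hy.2⟩, intervalIntegral.integral_undef hyS, add_zero]
  have hvIco : ContinuousOn v (Ioo a c) := by
    intro x hx
    obtain ⟨y, hxy, hyc⟩ := exists_between hx.2
    exact ((hlt y ⟨hx.1.le.trans hxy.le, hyc⟩).2.continuousAt
      (Icc_mem_nhds hx.1 hxy)).continuousWithinAt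
  obtain ⟨B, hB⟩ : ∃ B, ∀ x ∈ Ioo a c, ‖v x‖ ≤ B := by
    rcases hac.eq_or_lt with hac' | hac'
    · exact ⟨0, fun x hx => absurd (hx.1.trans hx.2) (by rw [← hac']; exact lt_irrefl a)⟩
    obtain ⟨t, ht, hsmall⟩ := exists_Ico_integral_le_half
      (w := fun z => 1 + |p z| + |q z|) hac' (hmono
        ((intervalIntegrable_const.add hp.abs).add hq.abs) le_rfl hac hcb)
    obtain ⟨B₀, hB₀⟩ := isCompact_Icc.exists_bound_of_continuousOn (hlt t ht).2
    refine ⟨max B₀ (2 * (|u t| + |v t|)), fun x hx => ?_⟩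
    rcases le_total x t with hxt | htx
    · exact (hB₀ x ⟨hx.1.le, hxt⟩).trans (le_max_left _ _)
    have hxb : x ≤ b := hx.2.le.trans hcb
    have hsub : Icc a x ⊆ Icc a b := Icc_subset_Icc_right hxb
    have hx' := hlt x ⟨hx.1.le, hx.2⟩
    have hle : ∫ z in t..x, (1 + |p z| + |q z|) ≤ ∫ z in t..c, (1 + |p z| + |q z|) :=
      intervalIntegral.integral_mono_interval le_rfl htx hx.2.le
        (Filter.Eventually.of_forall fun z => by positivity)
        (hmono ((intervalIntegrable_const.add hp.abs).add hq.abs) ht.1 ht.2.le hcb)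
    have hbd := abs_add_abs_le_of_linear_system ht.1 htx (hmono hp le_rfl hx.1.le hxb)
      (hmono hq le_rfl hx.1.le hxb) hx'.1 hx'.2 (fun y hy => hu y (hsub hy))
      (fun y hy => hv y (hsub hy)) (hle.trans hsmall)
    rw [Real.norm_eq_abs]
    exact le_trans (by linarith [abs_nonneg (u x)]) (le_max_right _ _)
  have hbd_ae : ∀ᵐ x ∂volume.restrict (Ioo a c), ‖v x‖ ≤ B :=
    (ae_restrict_iff' measurableSet_Ioo).2 (Filter.Eventually.of_forall hB)
  have hvm : AEStronglyMeasurable v (volume.restrict (Ioo a c)) :=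
    hvIco.aestronglyMeasurable measurableSet_Ioo
  have hmul : ∀ {g : ℝ → ℝ}, IntervalIntegrable g volume a b →
      IntervalIntegrable (fun z => g z * v z) volume a b := by
    intro g hg
    refine IntervalIntegrable.trans (b := c) ?_ ?_
    · have hg' := hmono hg le_rfl hac hcb
      rw [intervalIntegrable_iff_integrableOn_Ioo_of_le hac] at hg' ⊢
      exact Integrable.mul_bdd hg' hvm hbd_ae
    · refine ((hmono hg hac hcb le_rfl).mul_const k₂).congr ?_
      intro z hz
      rw [uIoc_of_le hcb] at hz
      simp only [hgt z hz]
  have hvi : IntervalIntegrable v volume a b := by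
    simpa using hmul (g := fun _ => 1) intervalIntegrable_const
  have huc : ContinuousOn u (uIcc a b) := by
    rw [uIcc_of_le hab]
    exact continuousOn_Icc_of_eq_const_add_integral hab hvi hu
  exact (hp.mul_continuousOn huc).sub (hmul hq)

/-- The product rule for primitives of integrable functions, in integrated form. -/
lemma const_add_integral_mul_const_add_integral {f g F G : ℝ → ℝ} {k l a b y : ℝ}
    (hy : y ∈ Icc a b)
    (hf : IntervalIntegrable f volume a b) (hg : IntervalIntegrable g volume a b)
    (hF : ∀ y ∈ Icc a b, F y = k + ∫ z in a..y, f z)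
    (hG : ∀ y ∈ Icc a b, G y = l + ∫ z in a..y, g z) :
    F y * G y = k * l + ∫ z in a..y, (f z * G z + F z * g z) := by
  have hsub : uIcc a y ⊆ uIcc a b := by
    rw [uIcc_of_le hy.1, uIcc_of_le (hy.1.trans hy.2)]; exact Icc_subset_Icc_right hy.2
  have hf' := hf.mono_set hsub
  have hg' := hg.mono_set hsub
  have hac : ∀ {h : ℝ → ℝ} (m : ℝ), IntervalIntegrable h volume a y →
      AbsolutelyContinuousOnInterval (fun x => m + ∫ z in a..x, h z) a y := fun m hh =>
    (contDiffOn_const (c := m)).absolutelyContinuousOnInterval.fun_add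
      (hh.absolutelyContinuousOnInterval_intervalIntegral left_mem_uIcc)
  have key := (hac k hf').integral_deriv_mul_eq_sub (hac l hg')
  simp only [intervalIntegral.integral_same, add_zero] at key
  rw [hF y hy, hG y hy, eq_add_of_sub_eq' key.symm]
  congr 1
  apply intervalIntegral.integral_congr_ae
  filter_upwards [hf'.ae_hasDerivAt_integral, hg'.ae_hasDerivAt_integral] with x hx₁ hx₂ hx
  have hxu : x ∈ uIcc a y := uIoc_subset_uIcc hx
  rw [uIoc_of_le hy.1] at hx
  have hxI : x ∈ Icc a b := ⟨hx.1.le, hx.2.trans hy.2⟩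
  rw [((hx₁ hxu a left_mem_uIcc).const_add k).deriv,
    ((hx₂ hxu a left_mem_uIcc).const_add l).deriv, hF x hxI, hG x hxI]

/-- Positivity of the solution of `D' = -q D`, `D a = 1`, for integrable `q`. -/
lemma pos_of_eq_one_add_integral {q D : ℝ → ℝ} {a b : ℝ} (hab : a ≤ b)
    (hq : IntervalIntegrable q volume a b) (hDc : ContinuousOn D (Icc a b))
    (hD : ∀ y ∈ Icc a b, D y = 1 + ∫ z in a..y, -(q z * D z)) : 0 < D b := by
  by_contra! hDb
  have hDa : D a = 1 := by simpa using hD a (left_mem_Icc.2 hab)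
  set Z : Set ℝ := Icc a b ∩ D ⁻¹' {0}
  have hZc : IsCompact Z := isCompact_Icc.of_isClosed_subset
    (hDc.preimage_isClosed_of_isClosed isClosed_Icc isClosed_singleton) inter_subset_left
  have hZne : Z.Nonempty := by
    obtain ⟨x, hx, hx0⟩ := intermediate_value_Icc' hab hDc
      (show (0 : ℝ) ∈ Icc (D b) (D a) from ⟨hDb, by rw [hDa]; exact zero_le_one⟩)
    exact ⟨x, hx, hx0⟩
  obtain ⟨c, ⟨hcI, hc0⟩, hcmin⟩ := hZc.exists_isLeast hZne
  have hc0 : D c = 0 := hc0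
  have hac : a < c := lt_of_le_of_ne hcI.1 fun h => by
    rw [← h, hDa] at hc0; exact one_ne_zero hc0
  have hmono : ∀ {g : ℝ → ℝ} {x y : ℝ}, IntervalIntegrable g volume a b → a ≤ x → x ≤ y →
      y ≤ b → IntervalIntegrable g volume x y := fun hg hx hxy hy => hg.mono_set (by
    rw [uIcc_of_le hab, uIcc_of_le hxy]; exact Icc_subset_Icc hx hy)
  obtain ⟨t, ht, hsmall⟩ := exists_Ico_integral_le_half hac (hmono hq.abs le_rfl hac.le hcI.2)
  have hqD : IntervalIntegrable (fun z => -(q z * D z)) volume a b :=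
    (hq.mul_continuousOn (uIcc_of_le hab ▸ hDc)).neg
  have hle := le_two_mul_of_forall_bound_improves (N := fun z => |D z|) (t := t) (s := c) (K := 0)
    (hDc.mono (Icc_subset_Icc ht.1 hcI.2)).abs (fun M hM x hx => by
      have hM0 : 0 ≤ M := (abs_nonneg _).trans (hM x hx)
      have h₁ := abs_sub_le_integral_of_eq_const_add_integral (h := fun z => M * |q z|)
        (ht.1.trans hx.1) hx.2 hcI.2 hqD hD
        ((hmono hq.abs (ht.1.trans hx.1) hx.2 hcI.2).const_mul M) (fun z hz => by
          rw [abs_neg, abs_mul, mul_comm]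
          exact mul_le_mul_of_nonneg_right (hM z ⟨hx.1.trans hz.1, hz.2⟩) (abs_nonneg _))
      rw [hc0, zero_sub, abs_neg, intervalIntegral.integral_const_mul] at h₁
      have h₂ : ∫ z in x..c, |q z| ≤ ∫ z in t..c, |q z| :=
        intervalIntegral.integral_mono_interval hx.1 hx.2 le_rfl
          (Filter.Eventually.of_forall fun z => abs_nonneg _)
          (hmono hq.abs ht.1 ht.2.le hcI.2)
      linarith [mul_le_mul_of_nonneg_left (h₂.trans hsmall) hM0]) t (left_mem_Icc.2 ht.2.le)
  have hDt : D t = 0 := by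
    have : |D t| ≤ 0 := by simpa using hle
    exact abs_nonpos_iff.1 this
  exact (hcmin ⟨⟨ht.1, ht.2.le.trans hcI.2⟩, hDt⟩).not_gt ht.2

/-- Liouville: the Wronskian of the fundamental system is positive. -/
lemma wronskian_pos_of_linear_system {p q u₁ v₁ u₂ v₂ : ℝ → ℝ} {a b : ℝ} (hab : a ≤ b)
    (hp : IntervalIntegrable p volume a b) (hq : IntervalIntegrable q volume a b)
    (hu₁ : ∀ y ∈ Icc a b, u₁ y = 1 + ∫ z in a..y, v₁ z)
    (hv₁ : ∀ y ∈ Icc a b, v₁ y = 0 + ∫ z in a..y, (p z * u₁ z - q z * v₁ z))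
    (hu₂ : ∀ y ∈ Icc a b, u₂ y = 0 + ∫ z in a..y, v₂ z)
    (hv₂ : ∀ y ∈ Icc a b, v₂ y = 1 + ∫ z in a..y, (p z * u₂ z - q z * v₂ z)) :
    0 < u₁ b * v₂ b - u₂ b * v₁ b := by
  have hf₁ := intervalIntegrable_of_linear_system hab hp hq hu₁ hv₁
  have hf₂ := intervalIntegrable_of_linear_system hab hp hq hu₂ hv₂
  have hvc₁ := continuousOn_Icc_of_eq_const_add_integral hab hf₁ hv₁
  have hvc₂ := continuousOn_Icc_of_eq_const_add_integral hab hf₂ hv₂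
  have hI := uIcc_of_le hab
  have hvi₁ : IntervalIntegrable v₁ volume a b := (hI ▸ hvc₁).intervalIntegrable
  have hvi₂ : IntervalIntegrable v₂ volume a b := (hI ▸ hvc₂).intervalIntegrable
  have huc₁ := continuousOn_Icc_of_eq_const_add_integral hab hvi₁ hu₁
  have huc₂ := continuousOn_Icc_of_eq_const_add_integral hab hvi₂ hu₂
  refine pos_of_eq_one_add_integral (D := fun y => u₁ y * v₂ y - u₂ y * v₁ y) hab hq
    ((huc₁.mul hvc₂).sub (huc₂.mul hvc₁)) fun y hy => ?_
  have hmono : ∀ {g : ℝ → ℝ}, IntervalIntegrable g volume a b →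
      IntervalIntegrable g volume a y := fun hg => hg.mono_set (by
    rw [hI, uIcc_of_le hy.1]; exact Icc_subset_Icc_right hy.2)
  rw [const_add_integral_mul_const_add_integral hy hvi₁ hf₂ hu₁ hv₂,
    const_add_integral_mul_const_add_integral hy hvi₂ hf₁ hu₂ hv₁, add_sub_add_comm,
    ← intervalIntegral.integral_sub]
  · rw [show (1 : ℝ) * 1 - 0 * 0 = 1 by norm_num]
    congr 2; ext z; ring
  · exact hmono ((hvi₁.mul_continuousOn (hI ▸ hvc₂)).add (hf₂.continuousOn_mul (hI ▸ huc₁)))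
  · exact hmono ((hvi₂.mul_continuousOn (hI ▸ hvc₁)).add (hf₁.continuousOn_mul (hI ▸ huc₂)))

/-- A primitive starting at `0` with positive initial slope has nonpositive slope at its first
return to `0`. -/
lemma slope_nonpos_of_first_return {u v : ℝ → ℝ} {a b : ℝ} (hab : a < b)
    (hvc : ContinuousOn v (Icc a b)) (hu : ∀ y ∈ Icc a b, u y = 0 + ∫ z in a..y, v z)
    (hva : 0 < v a) (hub : u b = 0) (hne : ∀ x ∈ Ioo a b, u x ≠ 0) : v b ≤ 0 := by
  by_contra! hvb
  have hvi : IntervalIntegrable v volume a b :=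
    (uIcc_of_le hab.le ▸ hvc : ContinuousOn v (uIcc a b)).intervalIntegrable
  have huc := continuousOn_Icc_of_eq_const_add_integral hab.le hvi hu
  have hinc : ∀ x y, a ≤ x → x < y → y ≤ b → (∀ z ∈ Ioo x y, 0 < v z) → u x < u y := by
    intro x y hax hxy hyb hpos
    have hm : ∀ {x' y'}, a ≤ x' → x' ≤ y' → y' ≤ b → IntervalIntegrable v volume x' y' :=
      fun h₁ h₂ h₃ => hvi.mono_set (by
        rw [uIcc_of_le hab.le, uIcc_of_le h₂]; exact Icc_subset_Icc h₁ h₃)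
    have h := intervalIntegral.intervalIntegral_pos_of_pos_on (hm hax hxy.le hyb) hpos hxy
    rw [← intervalIntegral.integral_interval_sub_left (hm le_rfl (hax.trans hxy.le) hyb)
      (hm le_rfl hax (hxy.le.trans hyb))] at h
    rw [hu x ⟨hax, hxy.le.trans hyb⟩, hu y ⟨hax.trans hxy.le, hyb⟩]
    linarith
  have hua : u a = 0 := by simpa using hu a (left_mem_Icc.2 hab.le)
  have hra : ∀ᶠ x in nhdsWithin a (Ioi a), 0 < v x := by
    have := (hvc a (left_mem_Icc.2 hab.le)).eventually_const_lt hva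
    rw [nhdsWithin_Icc_eq_nhdsGE hab] at this
    exact this.filter_mono (nhdsWithin_mono _ Ioi_subset_Ici_self)
  have hlb : ∀ᶠ x in nhdsWithin b (Iio b), 0 < v x := by
    have := (hvc b (right_mem_Icc.2 hab.le)).eventually_const_lt hvb
    rw [nhdsWithin_Icc_eq_nhdsLE hab] at this
    exact this.filter_mono (nhdsWithin_mono _ Iio_subset_Iic_self)
  obtain ⟨x, hx, hxv⟩ := (mem_nhdsGT_iff_exists_mem_Ioc_Ioo_subset
    (by linarith : a < (a + b) / 2)).1 hra
  obtain ⟨y, hy, hyv⟩ := (mem_nhdsLT_iff_exists_mem_Ico_Ioo_subset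
    (by linarith : (a + b) / 2 < b)).1 hlb
  have hxy : x ≤ y := hx.2.trans hy.1
  have hux : 0 < u x := hua ▸ hinc a x le_rfl hx.1 (hxy.trans hy.2.le) hxv
  have huy : u y < 0 := hub ▸ hinc y b (hx.1.le.trans hxy) hy.2 le_rfl hyv
  obtain ⟨z, hz, hz0⟩ := intermediate_value_Icc' hxy
    (huc.mono (Icc_subset_Icc hx.1.le hy.2.le)) ⟨huy.le, hux.le⟩
  exact hne z ⟨hx.1.trans_le hz.1, hz.2.trans_lt hy.2⟩ hz0


/-- Lemma "sign φ₁₂" (b): if b = min {x > a : φ₁₂(a,x) = 0}, then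
φ₁₁(a,b) < 0 and φ₂₂(a,b) < 0. -/
theorem stmt_1
    (I : Set ℝ) (hI : IsOpen I) (hIconn : I.OrdConnected)
    (α r σ : ℝ → ℝ)
    (hmα : Measurable α) (hmr : Measurable r) (hmσ : Measurable σ)
    (hσpos : ∀ x ∈ I, 0 < σ x)
    (hint1 : MeasureTheory.LocallyIntegrableOn (fun z => 1 / (σ z) ^ 2) I)
    (hint2 : MeasureTheory.LocallyIntegrableOn (fun z => α z / (σ z) ^ 2) I)
    (hint3 : MeasureTheory.LocallyIntegrableOn (fun z => r z / (σ z) ^ 2) I)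
    (φ11 φ12 φ21 φ22 : ℝ → ℝ → ℝ)
    (hφ11 : ∀ x ∈ I, ∀ y ∈ I, φ11 x y = 1 + ∫ z in x..y, φ21 x z)
    (hφ12 : ∀ x ∈ I, ∀ y ∈ I, φ12 x y = ∫ z in x..y, φ22 x z)
    (hφ21 : ∀ x ∈ I, ∀ y ∈ I, φ21 x y =
      ∫ z in x..y, (2 * r z / (σ z) ^ 2 * φ11 x z - 2 * α z / (σ z) ^ 2 * φ21 x z))
    (hφ22 : ∀ x ∈ I, ∀ y ∈ I, φ22 x y = 1 +
      ∫ z in x..y, (2 * r z / (σ z) ^ 2 * φ12 x z - 2 * α z / (σ z) ^ 2 * φ22 x z))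
    (a b : ℝ) (ha : a ∈ I) (hbI : b ∈ I)
    (hb : IsLeast {x : ℝ | a < x ∧ φ12 a x = 0} b) :
    φ11 a b < 0 ∧ φ22 a b < 0 := by
  obtain ⟨⟨hab, hb0⟩, hmin⟩ := hb
  have hsub : Icc a b ⊆ I := hIconn.out ha hbI
  have hcoef : ∀ {g : ℝ → ℝ}, LocallyIntegrableOn (fun z => g z / (σ z) ^ 2) I →
      IntervalIntegrable (fun z => 2 * g z / (σ z) ^ 2) volume a b := by
    intro g hg
    have h := (intervalIntegrable_iff_integrableOn_Icc_of_le hab.le).2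
      (hg.integrableOn_compact_subset hsub isCompact_Icc)
    simpa only [mul_div_assoc] using h.const_mul 2
  have hp := hcoef hint3
  have hq := hcoef hint2
  have hu₁ : ∀ y ∈ Icc a b, φ11 a y = 1 + ∫ z in a..y, φ21 a z :=
    fun y hy => hφ11 a ha y (hsub hy)
  have hv₁ : ∀ y ∈ Icc a b, φ21 a y = 0 + ∫ z in a..y,
      (2 * r z / (σ z) ^ 2 * φ11 a z - 2 * α z / (σ z) ^ 2 * φ21 a z) :=
    fun y hy => by rw [zero_add]; exact hφ21 a ha y (hsub hy)
  have hu₂ : ∀ y ∈ Icc a b, φ12 a y = 0 + ∫ z in a..y, φ22 a z :=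
    fun y hy => by rw [zero_add]; exact hφ12 a ha y (hsub hy)
  have hv₂ : ∀ y ∈ Icc a b, φ22 a y = 1 + ∫ z in a..y,
      (2 * r z / (σ z) ^ 2 * φ12 a z - 2 * α z / (σ z) ^ 2 * φ22 a z) :=
    fun y hy => hφ22 a ha y (hsub hy)
  have hdet := wronskian_pos_of_linear_system hab.le hp hq hu₁ hv₁ hu₂ hv₂
  rw [hb0, zero_mul, sub_zero] at hdet
  have hvc := continuousOn_Icc_of_eq_const_add_integral hab.le
    (intervalIntegrable_of_linear_system hab.le hp hq hu₂ hv₂) hv₂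
  have hslope : φ22 a b ≤ 0 := slope_nonpos_of_first_return hab hvc hu₂
    (by simp [hv₂ a (left_mem_Icc.2 hab.le)]) hb0
    fun x hx hx0 => (hmin ⟨hx.1, hx0⟩).not_gt hx.2
  rcases mul_pos_iff.1 hdet with h | h
  · exact absurd h.2 hslope.not_gt
  · exact h
end

section
/- Let g : I → [0,∞) be measurable with g/σ² locally integrable and ∫ₐᵇ g(z)/σ(z)² dz > 0. The second-order ODE r v − α v' − (σ²/2) v'' − g = 0 admits a solution (in the Carathéodory sense) that is non-negative on the compact interval [a,b] ⊂ I if and only if φ₁₂(a,x) > 0 for every x ∈ (a,b]. -/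
open MeasureTheory Set Filter Topology

/-- `F` is an absolutely continuous primitive of the interval integrable function `f` on `[a, b]`. -/
structure IsPrimitiveOn (F f : ℝ → ℝ) (a b : ℝ) : Prop where
  intervalIntegrable : IntervalIntegrable f volume a b
  eq_add_integral : ∀ x ∈ Icc a b, F x = F a + ∫ t in a..x, f t

/-- `(v, w)` is a Carathéodory solution of `v' = w`, `w' = p v - q w - h` on `[a, b]`. -/
structure IsCaratheodorySol (p q h v w : ℝ → ℝ) (a b : ℝ) : Prop where
  fst : IsPrimitiveOn v w a b
  snd : IsPrimitiveOn w (fun t => p t * v t - q t * w t - h t) a b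

theorem AbsolutelyContinuousOnInterval.congr_uIcc {F G : ℝ → ℝ} {a b : ℝ}
    (hF : AbsolutelyContinuousOnInterval F a b) (hFG : EqOn F G (uIcc a b)) :
    AbsolutelyContinuousOnInterval G a b := by
  rw [absolutelyContinuousOnInterval_iff] at hF ⊢
  intro ε hε
  obtain ⟨δ, hδ, H⟩ := hF ε hε
  refine ⟨δ, hδ, fun E hE hl => ?_⟩
  have := H E hE hl
  rwa [Finset.sum_congr rfl fun i hi => by
    rw [← hFG (hE.1 i hi).1, ← hFG (hE.1 i hi).2]]

theorem LipschitzOnWith.comp_absolutelyContinuousOnInterval {F G : ℝ → ℝ} {s : Set ℝ} {K : NNReal}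
    {a b : ℝ} (hG : LipschitzOnWith K G s) (hF : AbsolutelyContinuousOnInterval F a b)
    (hs : MapsTo F (uIcc a b) s) : AbsolutelyContinuousOnInterval (fun x => G (F x)) a b := by
  rw [absolutelyContinuousOnInterval_iff] at hF ⊢
  intro ε hε
  obtain ⟨δ, hδ, H⟩ := hF (ε / (K + 1)) (by positivity)
  refine ⟨δ, hδ, fun E hE hl => ?_⟩
  have h1 := H E hE hl
  have h2 : ∑ i ∈ Finset.range E.1, dist (G (F (E.2 i).1)) (G (F (E.2 i).2)) ≤
      K * ∑ i ∈ Finset.range E.1, dist (F (E.2 i).1) (F (E.2 i).2) := by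
    rw [Finset.mul_sum]
    exact Finset.sum_le_sum fun i hi => hG.dist_le_mul _ (hs (hE.1 i hi).1) _ (hs (hE.1 i hi).2)
  rw [lt_div_iff₀ (by positivity)] at h1
  have h3 : 0 ≤ ∑ i ∈ Finset.range E.1, dist (F (E.2 i).1) (F (E.2 i).2) :=
    Finset.sum_nonneg fun _ _ => dist_nonneg
  nlinarith

namespace IsPrimitiveOn

variable {F f : ℝ → ℝ} {a b : ℝ}

theorem absolutelyContinuousOnInterval (hF : IsPrimitiveOn F f a b) (hab : a ≤ b) :
    AbsolutelyContinuousOnInterval F a b := by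
  have h1 : AbsolutelyContinuousOnInterval (fun _ : ℝ => F a) a b :=
    ((LipschitzWith.const (F a)).lipschitzOnWith (s := uIcc a b)).absolutelyContinuousOnInterval
  refine (h1.add (hF.intervalIntegrable.absolutelyContinuousOnInterval_intervalIntegral
    (c := a) left_mem_uIcc)).congr_uIcc fun x hx => ?_
  rw [uIcc_of_le hab] at hx
  simpa using (hF.eq_add_integral x hx).symm

theorem continuousOn (hF : IsPrimitiveOn F f a b) (hab : a ≤ b) : ContinuousOn F (Icc a b) := by
  simpa [uIcc_of_le hab] using (hF.absolutelyContinuousOnInterval hab).continuousOn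

theorem ae_hasDerivAt (hF : IsPrimitiveOn F f a b) (hab : a ≤ b) :
    ∀ᵐ x, x ∈ Ioo a b → HasDerivAt F (f x) x := by
  filter_upwards [hF.intervalIntegrable.ae_hasDerivAt_integral] with x hx hxab
  have h1 := (hx (by rw [uIcc_of_le hab]; exact Ioo_subset_Icc_self hxab) a left_mem_uIcc).const_add
    (F a)
  refine h1.congr_of_eventuallyEq ?_
  filter_upwards [Icc_mem_nhds hxab.1 hxab.2] with y hy using hF.eq_add_integral y hy

theorem of_absolutelyContinuousOnInterval (hab : a ≤ b)
    (hF : AbsolutelyContinuousOnInterval F a b)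
    (hd : ∀ᵐ x, x ∈ Ioo a b → HasDerivAt F (f x) x) : IsPrimitiveOn F f a b := by
  have hae : deriv F =ᵐ[volume.restrict (Ioc a b)] f := by
    rw [← Measure.restrict_congr_set Ioo_ae_eq_Ioc]
    rw [EventuallyEq, ae_restrict_iff' measurableSet_Ioo]
    filter_upwards [hd] with x hx hxab using (hx hxab).deriv
  refine ⟨hF.intervalIntegrable_deriv.congr_ae (by rwa [uIoc_of_le hab]), fun x hx => ?_⟩
  have hx' : AbsolutelyContinuousOnInterval F a x :=
    hF.mono (by rw [uIcc_of_le hx.1, uIcc_of_le hab]; exact Icc_subset_Icc_right hx.2)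
  have : ∫ t in a..x, f t = ∫ t in a..x, deriv F t := by
    refine intervalIntegral.integral_congr_ae_restrict ?_
    rw [uIoc_of_le hx.1]
    exact EventuallyEq.symm
      (ae_restrict_of_ae_restrict_of_subset (Ioc_subset_Ioc_right hx.2) hae)
  rw [this, hx'.integral_deriv_eq_sub]
  ring

theorem integral_sub (hF : IsPrimitiveOn F f a b) {x y : ℝ} (hx : x ∈ Icc a b) (hy : y ∈ Icc a b) :
    ∫ t in x..y, f t = F y - F x := by
  have h : ∀ z ∈ Icc a b, IntervalIntegrable f volume a z := fun z hz =>
    hF.intervalIntegrable.mono_set (by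
      rw [uIcc_of_le hz.1, uIcc_of_le (hz.1.trans hz.2)]; exact Icc_subset_Icc_right hz.2)
  rw [hF.eq_add_integral x hx, hF.eq_add_integral y hy, add_sub_add_left_eq_sub,
    intervalIntegral.integral_interval_sub_left (h y hy) (h x hx)]

theorem mono (hF : IsPrimitiveOn F f a b) {c d : ℝ} (hac : a ≤ c) (hcd : c ≤ d) (hdb : d ≤ b) :
    IsPrimitiveOn F f c d where
  intervalIntegrable := hF.intervalIntegrable.mono_set (by
    rw [uIcc_of_le hcd, uIcc_of_le (hac.trans (hcd.trans hdb))]; exact Icc_subset_Icc hac hdb)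
  eq_add_integral x hx := by
    rw [hF.integral_sub ⟨hac, hcd.trans hdb⟩ ⟨hac.trans hx.1, hx.2.trans hdb⟩]
    ring

theorem lt_of_pos (hF : IsPrimitiveOn F f a b) {c d : ℝ} (hac : a ≤ c) (hcd : c < d) (hdb : d ≤ b)
    (hf : ∀ x ∈ Ioo c d, 0 < f x) : F c < F d := by
  have := intervalIntegral.intervalIntegral_pos_of_pos_on
    (hF.mono hac hcd.le hdb).intervalIntegrable hf hcd
  rw [hF.integral_sub ⟨hac, hcd.le.trans hdb⟩ ⟨hac.trans hcd.le, hdb⟩] at this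
  linarith

theorem hasDerivAt_of_continuousOn (hF : IsPrimitiveOn F f a b) (hf : ContinuousOn f (Icc a b))
    {x : ℝ} (hx : x ∈ Ioo a b) : HasDerivAt F (f x) x := by
  have hfx : ContinuousAt f x := hf.continuousAt (Icc_mem_nhds hx.1 hx.2)
  have h1 := (intervalIntegral.integral_hasDerivAt_right (a := a) (b := x) (f := f)
    (hF.mono le_rfl hx.1.le hx.2.le).intervalIntegrable
    (hf.mono Ioo_subset_Icc_self |>.stronglyMeasurableAtFilter isOpen_Ioo x hx) hfx).const_add (F a)
  refine h1.congr_of_eventuallyEq ?_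
  filter_upwards [Icc_mem_nhds hx.1 hx.2] with y hy using hF.eq_add_integral y hy

theorem exp (hF : IsPrimitiveOn F f a b) (hab : a ≤ b) :
    IsPrimitiveOn (fun x => Real.exp (F x)) (fun x => f x * Real.exp (F x)) a b := by
  have hac := hF.absolutelyContinuousOnInterval hab
  obtain ⟨C, hC⟩ := hac.exists_bound
  obtain ⟨K, hK⟩ := (Real.contDiff_exp (n := 1)).contDiffOn.exists_lipschitzOnWith one_ne_zero
    (convex_Icc (-C) C) isCompact_Icc
  refine of_absolutelyContinuousOnInterval hab
    (hK.comp_absolutelyContinuousOnInterval hac fun x hx => abs_le.1 (hC x hx)) ?_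
  filter_upwards [hF.ae_hasDerivAt hab] with x hx hxab
  simpa [mul_comm] using (hx hxab).exp

theorem add (hF : IsPrimitiveOn F f a b) {G g : ℝ → ℝ} (hG : IsPrimitiveOn G g a b) (hab : a ≤ b) :
    IsPrimitiveOn (fun x => F x + G x) (fun x => f x + g x) a b := by
  refine of_absolutelyContinuousOnInterval hab
    ((hF.absolutelyContinuousOnInterval hab).fun_add (hG.absolutelyContinuousOnInterval hab)) ?_
  filter_upwards [hF.ae_hasDerivAt hab, hG.ae_hasDerivAt hab] with x hx hy hxab
  exact (hx hxab).add (hy hxab)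

theorem sub (hF : IsPrimitiveOn F f a b) {G g : ℝ → ℝ} (hG : IsPrimitiveOn G g a b) (hab : a ≤ b) :
    IsPrimitiveOn (fun x => F x - G x) (fun x => f x - g x) a b := by
  refine of_absolutelyContinuousOnInterval hab
    ((hF.absolutelyContinuousOnInterval hab).fun_sub (hG.absolutelyContinuousOnInterval hab)) ?_
  filter_upwards [hF.ae_hasDerivAt hab, hG.ae_hasDerivAt hab] with x hx hy hxab
  exact (hx hxab).sub (hy hxab)

theorem const_mul (hF : IsPrimitiveOn F f a b) (c : ℝ) :
    IsPrimitiveOn (fun x => c * F x) (fun x => c * f x) a b where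
  intervalIntegrable := hF.intervalIntegrable.const_mul c
  eq_add_integral x hx := by
    rw [intervalIntegral.integral_const_mul, hF.eq_add_integral x hx, mul_add]

theorem mul (hF : IsPrimitiveOn F f a b) {G g : ℝ → ℝ} (hG : IsPrimitiveOn G g a b) (hab : a ≤ b) :
    IsPrimitiveOn (fun x => F x * G x) (fun x => f x * G x + F x * g x) a b := by
  refine of_absolutelyContinuousOnInterval hab
    ((hF.absolutelyContinuousOnInterval hab).fun_mul (hG.absolutelyContinuousOnInterval hab)) ?_
  filter_upwards [hF.ae_hasDerivAt hab, hG.ae_hasDerivAt hab] with x hx hy hxab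
  exact (hx hxab).mul (hy hxab)

theorem congr_deriv (hF : IsPrimitiveOn F f a b) {g : ℝ → ℝ} (hab : a ≤ b)
    (hfg : ∀ x ∈ Ioo a b, f x = g x) : IsPrimitiveOn F g a b := by
  refine of_absolutelyContinuousOnInterval hab (hF.absolutelyContinuousOnInterval hab) ?_
  filter_upwards [hF.ae_hasDerivAt hab] with x hx hxab
  exact hfg x hxab ▸ hx hxab

end IsPrimitiveOn

theorem IntervalIntegrable.isPrimitiveOn {f : ℝ → ℝ} {a b : ℝ}
    (hf : IntervalIntegrable f volume a b) (c : ℝ) :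
    IsPrimitiveOn (fun x => c + ∫ t in a..x, f t) f a b :=
  ⟨hf, fun x _ => by simp⟩

/-- A short-interval form of Grönwall's inequality with integrable coefficients. -/
theorem abs_add_abs_le_of_integral_le_half {p q h v w : ℝ → ℝ} {y x : ℝ} (hyx : y ≤ x)
    (hp : IntervalIntegrable p volume y x) (hq : IntervalIntegrable q volume y x)
    (hh : IntervalIntegrable h volume y x)
    (hsol : IsCaratheodorySol p q h v w y x)
    (hk : ∫ t in y..x, (1 + |p t| + |q t|) ≤ 1 / 2) :
    |v x| + |w x| ≤ 2 * (|v y| + |w y| + ∫ t in y..x, |h t|) := by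
  have hvc := hsol.fst.continuousOn hyx
  have hwc := hsol.snd.continuousOn hyx
  obtain ⟨ξ, hξ, hmax⟩ := isCompact_Icc.exists_isMaxOn (nonempty_Icc.2 hyx)
    (hvc.abs.add hwc.abs)
  have hmax' : ∀ t ∈ Icc y x, |v t| + |w t| ≤ |v ξ| + |w ξ| := fun t ht => hmax ht
  set U := |v ξ| + |w ξ| with hU
  have hU0 : 0 ≤ U := by positivity
  have hkint : IntervalIntegrable (fun t => 1 + |p t| + |q t|) volume y x :=
    (intervalIntegrable_const.add hp.abs).add hq.abs
  have hv := hsol.fst.eq_add_integral ξ hξ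
  have hw := hsol.snd.eq_add_integral ξ hξ
  have hsub : uIcc y ξ ⊆ uIcc y x := by
    rw [uIcc_of_le hξ.1, uIcc_of_le hyx]; exact Icc_subset_Icc_right hξ.2
  have hvi := hsol.fst.intervalIntegrable.mono_set hsub
  have hwi := hsol.snd.intervalIntegrable.mono_set hsub
  have h1 : |∫ t in y..ξ, w t| + |∫ t in y..ξ, (p t * v t - q t * w t - h t)| ≤
      ∫ t in y..ξ, (U * (1 + |p t| + |q t|) + |h t|) := by
    refine (add_le_add (intervalIntegral.abs_integral_le_integral_abs hξ.1)
      (intervalIntegral.abs_integral_le_integral_abs hξ.1)).trans ?_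
    rw [← intervalIntegral.integral_add hvi.abs hwi.abs]
    refine intervalIntegral.integral_mono_on hξ.1 (hvi.abs.add hwi.abs)
      (((hkint.const_mul U).add hh.abs).mono_set hsub) fun t ht => ?_
    have hm := hmax' t ⟨ht.1, ht.2.trans hξ.2⟩
    have h2 : |p t * v t - q t * w t - h t| ≤ |p t| * |v t| + |q t| * |w t| + |h t| := by
      rw [← abs_mul, ← abs_mul]
      exact (abs_sub _ _).trans (add_le_add_left (abs_sub _ _) _)
    have h3 : |p t| * |v t| ≤ |p t| * U := by
      gcongr; linarith [abs_nonneg (w t)]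
    have h4 : |q t| * |w t| ≤ |q t| * U := by
      gcongr; linarith [abs_nonneg (v t)]
    nlinarith [abs_nonneg (v t)]
  have h5 : ∫ t in y..ξ, (U * (1 + |p t| + |q t|) + |h t|) ≤
      ∫ t in y..x, (U * (1 + |p t| + |q t|) + |h t|) :=
    intervalIntegral.integral_mono_interval le_rfl hξ.1 hξ.2
      (ae_of_all _ fun t => by dsimp; positivity) ((hkint.const_mul U).add hh.abs)
  rw [intervalIntegral.integral_add (hkint.const_mul U) hh.abs,
    intervalIntegral.integral_const_mul] at h5
  have h6 : U ≤ |v y| + |w y| + (|∫ t in y..ξ, w t| +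
      |∫ t in y..ξ, (p t * v t - q t * w t - h t)|) := by
    rw [hU, hv, hw]
    have := abs_add_le (v y) (∫ t in y..ξ, w t)
    have := abs_add_le (w y) (∫ t in y..ξ, (p t * v t - q t * w t - h t))
    linarith
  have h7 := hmax' x ⟨hyx, le_rfl⟩
  nlinarith

/-- Functions satisfying the integral equations with the convention that divergent integrals vanish
are genuine solutions. -/
theorem IsCaratheodorySol.of_integral_eq {p q h v w : ℝ → ℝ} {a b : ℝ} (hab : a ≤ b)
    (hp : IntervalIntegrable p volume a b) (hq : IntervalIntegrable q volume a b)
    (hh : IntervalIntegrable h volume a b)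
    (hv : ∀ x ∈ Icc a b, v x = v a + ∫ t in a..x, w t)
    (hw : ∀ x ∈ Icc a b, w x = w a + ∫ t in a..x, (p t * v t - q t * w t - h t)) :
    IsCaratheodorySol p q h v w a b := by
  set f : ℝ → ℝ := fun t => p t * v t - q t * w t - h t with hf
  have hmono : ∀ {φ : ℝ → ℝ} {c d : ℝ}, a ≤ c → c ≤ d → d ≤ b →
      IntervalIntegrable φ volume a b → IntervalIntegrable φ volume c d :=
    fun hac hcd hdb hφ => hφ.mono_set (by
      rw [uIcc_of_le hcd, uIcc_of_le (hac.trans (hcd.trans hdb))]; exact Icc_subset_Icc hac hdb)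
  set S : Set ℝ := {x | x ∈ Icc a b ∧ IntervalIntegrable f volume a x} with hS
  have haS : a ∈ S := ⟨⟨le_rfl, hab⟩, by simp⟩
  have hbdd : BddAbove S := ⟨b, fun x hx => hx.1.2⟩
  set c := sSup S with hc
  have hac : a ≤ c := le_csSup hbdd haS
  have hcb : c ≤ b := csSup_le ⟨a, haS⟩ fun x hx => hx.1.2
  have hsol : ∀ x ∈ Ico a c, IsCaratheodorySol p q h v w a x := by
    intro x hx
    obtain ⟨y, hy, hxy⟩ := exists_lt_of_lt_csSup ⟨a, haS⟩ hx.2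
    have hfx : IntervalIntegrable f volume a x := hy.2.mono_set (by
      rw [uIcc_of_le hx.1, uIcc_of_le hy.1.1]; exact Icc_subset_Icc_right hxy.le)
    have hwx : IsPrimitiveOn w f a x :=
      ⟨hfx, fun z hz => hw z ⟨hz.1, hz.2.trans (hx.2.le.trans hcb)⟩⟩
    have hwi : IntervalIntegrable w volume a x :=
      ContinuousOn.intervalIntegrable_of_Icc hx.1 (hwx.continuousOn hx.1)
    exact ⟨⟨hwi, fun z hz => hv z ⟨hz.1, hz.2.trans (hx.2.le.trans hcb)⟩⟩, hwx⟩
  have hwgt : ∀ x ∈ Ioc c b, w x = w a := by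
    intro x hx
    rw [hw x ⟨hac.trans hx.1.le, hx.2⟩, intervalIntegral.integral_undef, add_zero]
    exact fun hi => (le_csSup hbdd (show x ∈ S from ⟨⟨hac.trans hx.1.le, hx.2⟩, hi⟩)).not_gt hx.1
  have hwcont : ContinuousOn w (Ico a c) := by
    intro x hx
    obtain ⟨y, hxy, hyc⟩ := exists_between hx.2
    have h1 := ((hsol y ⟨hx.1.trans hxy.le, hyc⟩).snd.continuousOn (hx.1.trans hxy.le)) x
      ⟨hx.1, hxy.le⟩
    refine h1.mono_of_mem_nhdsWithin ?_
    filter_upwards [self_mem_nhdsWithin, mem_nhdsWithin_of_mem_nhds (Iio_mem_nhds hxy)] with z h2 h3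
    exact ⟨h2.1, le_of_lt h3⟩
  obtain ⟨C, hC⟩ : ∃ C, ∀ x ∈ Ico a c, |w x| ≤ C := by
    rcases hac.eq_or_lt with hac' | hac'
    · exact ⟨0, fun x hx => absurd (hx.1.trans_lt hx.2) (by rw [← hac']; exact lt_irrefl _)⟩
    set k : ℝ → ℝ := fun t => 1 + |p t| + |q t|
    have hk : IntervalIntegrable k volume a b := (intervalIntegrable_const.add hp.abs).add hq.abs
    have hkP := (hk.isPrimitiveOn 0)
    obtain ⟨y, hy, hky⟩ : ∃ y ∈ Ico a c, ∫ t in y..c, k t ≤ 1 / 2 := by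
      have hcc := ((hkP.mono le_rfl hac hcb).continuousOn hac) c ⟨hac, le_rfl⟩
      have := (hcc.mono Ico_subset_Icc_self).eventually
        (lt_mem_nhds (show (0 + ∫ t in a..c, k t) - 1 / 2 < 0 + ∫ t in a..c, k t by linarith))
      have hne : (𝓝[Ico a c] c).NeBot := by
        rw [nhdsWithin_Ico_eq_nhdsLT hac']; infer_instance
      obtain ⟨y, hy1, hy2⟩ := (this.and self_mem_nhdsWithin).exists
      refine ⟨y, hy2, ?_⟩
      rw [hkP.integral_sub ⟨hy2.1, hy2.2.le.trans hcb⟩ ⟨hac, hcb⟩]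
      linarith
    obtain ⟨C₁, hC₁⟩ := isCompact_Icc.exists_bound_of_continuousOn ((hsol y hy).snd.continuousOn hy.1)
    refine ⟨max C₁ (2 * (|v y| + |w y| + ∫ t in y..c, |h t|)), fun x hx => ?_⟩
    rcases le_total x y with hxy | hxy
    · exact (hC₁ x ⟨hx.1, hxy⟩).trans (le_max_left _ _)
    refine le_trans ?_ (le_max_right _ _)
    have hxb := hx.2.le.trans hcb
    have h1 := abs_add_abs_le_of_integral_le_half hxy (hmono hy.1 hxy hxb hp)
      (hmono hy.1 hxy hxb hq) (hmono hy.1 hxy hxb hh)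
      ⟨(hsol x hx).fst.mono hy.1 hxy le_rfl, (hsol x hx).snd.mono hy.1 hxy le_rfl⟩
      ((intervalIntegral.integral_mono_interval le_rfl hxy hx.2.le
        (ae_of_all _ fun t => by dsimp; positivity) (hmono hy.1 hy.2.le hcb hk)).trans hky)
    have h2 : ∫ t in y..x, |h t| ≤ ∫ t in y..c, |h t| :=
      intervalIntegral.integral_mono_interval le_rfl hxy hx.2.le
        (ae_of_all _ fun t => abs_nonneg _) (hmono hy.1 hy.2.le hcb hh).abs
    linarith [abs_nonneg (v x)]
  have hwint : IntervalIntegrable w volume a b := by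
    have h1 : IntervalIntegrable w volume a c := by
      rw [intervalIntegrable_iff_integrableOn_Ico_of_le hac]
      exact Integrable.of_bound (hwcont.aestronglyMeasurable measurableSet_Ico) C
        ((ae_restrict_iff' measurableSet_Ico).2 (ae_of_all _ hC))
    have h2 : IntervalIntegrable w volume c b := by
      refine (intervalIntegrable_const (c := w a)).congr fun x hx => ?_
      rw [uIoc_of_le hcb] at hx
      exact (hwgt x hx).symm
    exact h1.trans h2
  have hvP : IsPrimitiveOn v w a b := ⟨hwint, hv⟩
  have hbound : ∀ᵐ x ∂volume.restrict (uIoc a b), ‖w x‖ ≤ max C |w a| := by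
    rw [uIoc_of_le hab, ae_restrict_iff' measurableSet_Ioc]
    filter_upwards [Measure.ae_ne volume c] with x hxc hx
    rcases lt_or_gt_of_ne hxc with hlt | hgt
    · exact (hC x ⟨hx.1.le, hlt⟩).trans (le_max_left _ _)
    · rw [hwgt x ⟨hgt, hx.2⟩]; exact le_max_right _ _
  refine ⟨hvP, ⟨(IntervalIntegrable.sub ?_ ?_).sub hh, hw⟩⟩
  · exact hp.mul_continuousOn (by rw [uIcc_of_le hab]; exact hvP.continuousOn hab)
  · rw [intervalIntegrable_iff] at hq hwint ⊢
    exact hq.mul_bdd hwint.aestronglyMeasurable hbound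

theorem ContinuousOn.exists_pos_on_Icc_right {f : ℝ → ℝ} {a b : ℝ} (hf : ContinuousOn f (Icc a b))
    (hab : a < b) (ha : 0 < f a) : ∃ y ∈ Ioc a b, ∀ x ∈ Icc a y, 0 < f x := by
  have h := (hf a ⟨le_rfl, hab.le⟩).eventually (lt_mem_nhds ha)
  rw [nhdsWithin_Icc_eq_nhdsGE hab] at h
  obtain ⟨y, hy, hsub⟩ := mem_nhdsGE_iff_exists_Icc_subset.1 h
  exact ⟨min y b, ⟨lt_min hy hab, min_le_right _ _⟩,
    fun x hx => hsub ⟨hx.1, hx.2.trans (min_le_left _ _)⟩⟩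

theorem ContinuousOn.exists_pos_on_Icc_left {f : ℝ → ℝ} {a b : ℝ} (hf : ContinuousOn f (Icc a b))
    (hab : a < b) (hb : 0 < f b) : ∃ y ∈ Ico a b, ∀ x ∈ Icc y b, 0 < f x := by
  have h := (hf b ⟨hab.le, le_rfl⟩).eventually (lt_mem_nhds hb)
  rw [nhdsWithin_Icc_eq_nhdsLE hab] at h
  obtain ⟨y, hy, hsub⟩ := mem_nhdsLE_iff_exists_Icc_subset.1 h
  exact ⟨max y a, ⟨le_max_right _ _, max_lt hy hab⟩,
    fun x hx => hsub ⟨(le_max_left _ _).trans hx.1, hx.2⟩⟩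

theorem integral_eq_zero_of_integral_mul_eq_zero {h P : ℝ → ℝ} {a b : ℝ} (hab : a ≤ b)
    (hh : IntervalIntegrable h volume a b) (h0 : ∀ x ∈ Icc a b, 0 ≤ h x)
    (hPc : ContinuousOn P (Icc a b)) (hP : ∀ x ∈ Ioo a b, 0 < P x)
    (hz : ∫ t in a..b, h t * P t = 0) : ∫ t in a..b, h t = 0 := by
  have hnn : 0 ≤ᵐ[volume.restrict (Ioc a b)] fun t => h t * P t := by
    rw [← Measure.restrict_congr_set Ioo_ae_eq_Ioc, EventuallyLE,
      ae_restrict_iff' measurableSet_Ioo]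
    exact ae_of_all _ fun x hx => mul_nonneg (h0 x (Ioo_subset_Icc_self hx)) (hP x hx).le
  rw [intervalIntegral.integral_eq_zero_iff_of_le_of_nonneg_ae hab hnn
    (hh.mul_continuousOn (by rwa [uIcc_of_le hab])), ← Measure.restrict_congr_set Ioo_ae_eq_Ioc,
    EventuallyEq, ae_restrict_iff' measurableSet_Ioo] at hz
  rw [intervalIntegral.integral_of_le hab, ← Measure.restrict_congr_set Ioo_ae_eq_Ioc]
  refine integral_eq_zero_of_ae ?_
  rw [EventuallyEq, ae_restrict_iff' measurableSet_Ioo]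
  filter_upwards [hz] with x hx hxab
  exact (mul_eq_zero.1 (hx hxab)).resolve_right (hP x hxab).ne'

theorem integral_mul_eq_zero_of_integral_eq_zero {h P : ℝ → ℝ} {a b : ℝ} (hab : a ≤ b)
    (hh : IntervalIntegrable h volume a b) (h0 : ∀ x ∈ Icc a b, 0 ≤ h x)
    (hz : ∫ t in a..b, h t = 0) : ∫ t in a..b, h t * P t = 0 := by
  have hnn : 0 ≤ᵐ[volume.restrict (Ioc a b)] h := by
    rw [EventuallyLE, ae_restrict_iff' measurableSet_Ioc]
    exact ae_of_all _ fun x hx => h0 x (Ioc_subset_Icc_self hx)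
  rw [intervalIntegral.integral_eq_zero_iff_of_le_of_nonneg_ae hab hnn hh] at hz
  rw [intervalIntegral.integral_of_le hab]
  refine integral_eq_zero_of_ae ?_
  filter_upwards [hz] with x hx
  simp [hx]

namespace IsCaratheodorySol

variable {p q h u u' v w E φ₁ φ₁' φ₂ φ₂' : ℝ → ℝ} {a b : ℝ}

theorem linear_combination (hab : a ≤ b) {h₁ h₂ : ℝ → ℝ} (hu : IsCaratheodorySol p q h₁ u u' a b)
    (hv : IsCaratheodorySol p q h₂ v w a b) (c d : ℝ) (hh : ∀ x, h x = c * h₁ x + d * h₂ x) :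
    IsCaratheodorySol p q h (fun x => c * u x + d * v x) (fun x => c * u' x + d * w x) a b where
  fst := (hu.fst.const_mul c).add (hv.fst.const_mul d) hab
  snd := ((hu.snd.const_mul c).add (hv.snd.const_mul d) hab).congr_deriv hab
    fun x _ => by rw [hh]; ring

/-- Abel's identity: the Wronskian times an integrating factor. -/
theorem wronskian_mul (hab : a ≤ b) (hu : IsCaratheodorySol p q (fun _ => 0) u u' a b)
    (hv : IsCaratheodorySol p q h v w a b) (hE : IsPrimitiveOn E (fun t => q t * E t) a b) :
    IsPrimitiveOn (fun x => (u x * w x - v x * u' x) * E x) (fun t => -(h t * (u t * E t))) a b :=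
  (((hu.fst.mul hv.snd hab).sub (hv.fst.mul hu.snd hab) hab).mul hE hab).congr_deriv hab
    fun x _ => by ring

theorem wronskian_mul_eq_one (hab : a ≤ b)
    (hφ₁ : IsCaratheodorySol p q (fun _ => 0) φ₁ φ₁' a b)
    (hφ₂ : IsCaratheodorySol p q (fun _ => 0) φ₂ φ₂' a b)
    (hE : IsPrimitiveOn E (fun t => q t * E t) a b) (hEa : E a = 1)
    (h₁ : φ₁ a = 1) (h₂ : φ₂ a = 0) (h₂' : φ₂' a = 1) {x : ℝ} (hx : x ∈ Icc a b) :
    (φ₁ x * φ₂' x - φ₂ x * φ₁' x) * E x = 1 := by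
  have := (wronskian_mul hab hφ₁ hφ₂ hE).eq_add_integral x hx
  simpa [hEa, h₁, h₂, h₂'] using this

/-- Variation of constants. -/
theorem exists_of_fundamental (hab : a ≤ b) (hh : IntervalIntegrable h volume a b)
    (hφ₁ : IsCaratheodorySol p q (fun _ => 0) φ₁ φ₁' a b)
    (hφ₂ : IsCaratheodorySol p q (fun _ => 0) φ₂ φ₂' a b)
    (hE : IsPrimitiveOn E (fun t => q t * E t) a b) (hEa : E a = 1)
    (h₁ : φ₁ a = 1) (h₂ : φ₂ a = 0) (h₂' : φ₂' a = 1) :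
    ∃ v w, IsCaratheodorySol p q h v w a b ∧ v a = 0 ∧ w a = 0 := by
  have hint : ∀ {φ : ℝ → ℝ}, ContinuousOn φ (Icc a b) →
      IntervalIntegrable (fun t => h t * (φ t * E t)) volume a b := fun hφ =>
    hh.mul_continuousOn (by rw [uIcc_of_le hab]; exact hφ.mul (hE.continuousOn hab))
  have hA := (hint (hφ₂.fst.continuousOn hab)).isPrimitiveOn 0
  have hB := (hint (hφ₁.fst.continuousOn hab)).isPrimitiveOn 0
  have hW := fun x (hx : x ∈ Ioo a b) =>
    wronskian_mul_eq_one hab hφ₁ hφ₂ hE hEa h₁ h₂ h₂' (Ioo_subset_Icc_self hx)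
  refine ⟨_, _, ⟨((hA.mul hφ₁.fst hab).sub (hB.mul hφ₂.fst hab) hab).congr_deriv
    (g := fun x => (0 + ∫ t in a..x, h t * (φ₂ t * E t)) * φ₁' x -
      (0 + ∫ t in a..x, h t * (φ₁ t * E t)) * φ₂' x) hab fun x hx => ?_,
    ((hA.mul hφ₁.snd hab).sub (hB.mul hφ₂.snd hab) hab).congr_deriv hab fun x hx => ?_⟩, ?_, ?_⟩
  · ring
  · linear_combination -(h x) * hW x hx
  · simp
  · simp

theorem exists_nonneg (hab : a < b) (hh : IntervalIntegrable h volume a b)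
    (hφ₁ : IsCaratheodorySol p q (fun _ => 0) φ₁ φ₁' a b)
    (hφ₂ : IsCaratheodorySol p q (fun _ => 0) φ₂ φ₂' a b)
    (hE : IsPrimitiveOn E (fun t => q t * E t) a b) (hEa : E a = 1)
    (h₁ : φ₁ a = 1) (h₂ : φ₂ a = 0) (h₂' : φ₂' a = 1) (hpos : ∀ x ∈ Ioc a b, 0 < φ₂ x) :
    ∃ v w, IsCaratheodorySol p q h v w a b ∧ ∀ x ∈ Icc a b, 0 ≤ v x := by
  obtain ⟨v, w, hv, hva, hwa⟩ := exists_of_fundamental hab.le hh hφ₁ hφ₂ hE hEa h₁ h₂ h₂'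
  have hs := hv.fst.add hφ₂.fst hab.le
  obtain ⟨y, hy, hyp⟩ := ((hv.snd.continuousOn hab.le).add
    (hφ₂.snd.continuousOn hab.le)).exists_pos_on_Icc_right hab (by simp [hwa, h₂'])
  have hφ₂c := (hφ₂.fst.continuousOn hab.le).mono (Icc_subset_Icc_left hy.1.le)
  have hvc := (hv.fst.continuousOn hab.le).mono (Icc_subset_Icc_left hy.1.le)
  obtain ⟨ξ, hξ, hmin⟩ := isCompact_Icc.exists_isMinOn (nonempty_Icc.2 hy.2) hφ₂c
  obtain ⟨M, hM⟩ := isCompact_Icc.exists_bound_of_continuousOn hvc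
  have hm := hpos ξ ⟨hy.1.trans_le hξ.1, hξ.2⟩
  refine ⟨_, _, hv.linear_combination hab.le hφ₂ 1 (max 1 (M / φ₂ ξ)) fun x => by ring,
    fun x hx => ?_⟩
  rcases hx.1.eq_or_lt with rfl | hax
  · simp [hva, h₂]
  have hφx := hpos x ⟨hax, hx.2⟩
  rcases le_total x y with hxy | hxy
  · have h3 := hs.lt_of_pos le_rfl hax hx.2 fun t ht => hyp t ⟨ht.1.le, ht.2.le.trans hxy⟩
    simp only [hva, h₂] at h3
    nlinarith [le_max_left 1 (M / φ₂ ξ)]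
  · have h3 : φ₂ ξ ≤ φ₂ x := hmin ⟨hxy, hx.2⟩
    have h4 := neg_le_of_abs_le (hM x ⟨hxy, hx.2⟩)
    have h5 : M ≤ max 1 (M / φ₂ ξ) * φ₂ ξ := by
      rw [← div_le_iff₀ hm]; exact le_max_right _ _
    have h6 : max 1 (M / φ₂ ξ) * φ₂ ξ ≤ max 1 (M / φ₂ ξ) * φ₂ x := by gcongr
    linarith

/-- A solution with vanishing data at `d` is negative just to the right of `d` if the forcing term
does not vanish there. -/
theorem exists_neg_of_eq_zero {d : ℝ} (hdb : d < b) (hh : IntervalIntegrable h volume d b)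
    (h0 : ∀ x ∈ Icc d b, 0 ≤ h x) (hhpos : ∀ x ∈ Ioc d b, ∫ t in d..x, h t ≠ 0)
    (hu : IsCaratheodorySol p q (fun _ => 0) u u' d b) (hud : 0 < u d)
    (hv : IsCaratheodorySol p q h v w d b) (hE : IsPrimitiveOn E (fun t => q t * E t) d b)
    (hEpos : ∀ x, 0 < E x) (hvd : v d = 0) (hwd : w d = 0) : ∃ y ∈ Icc d b, v y < 0 := by
  obtain ⟨y, hy, hyp⟩ := (hu.fst.continuousOn hdb.le).exists_pos_on_Icc_right hdb hud
  have hW := wronskian_mul hdb.le hu hv hE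
  have hneg : ∀ x ∈ Ioo d y, u x * w x - v x * u' x < 0 := by
    intro x hx
    have hxb : x ≤ b := hx.2.le.trans hy.2
    have h1 := hW.eq_add_integral x ⟨hx.1.le, hxb⟩
    simp only [hvd, hwd, intervalIntegral.integral_neg] at h1
    have hsub : Icc d x ⊆ Icc d b := Icc_subset_Icc_right hxb
    have hup : ∀ t ∈ Icc d x, 0 < u t * E t := fun t ht =>
      mul_pos (hyp t ⟨ht.1, ht.2.trans hx.2.le⟩) (hEpos t)
    have h2 : 0 ≤ ∫ t in d..x, h t * (u t * E t) :=
      intervalIntegral.integral_nonneg hx.1.le fun t ht =>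
        mul_nonneg (h0 t (hsub ht)) (hup t ht).le
    have h3 : ∫ t in d..x, h t * (u t * E t) ≠ 0 := fun hz => hhpos x ⟨hx.1, hxb⟩
      (integral_eq_zero_of_integral_mul_eq_zero hx.1.le
        (hh.mono_set (by rwa [uIcc_of_le hx.1.le, uIcc_of_le hdb.le]))
        (fun t ht => h0 t (hsub ht))
        (((hu.fst.continuousOn hdb.le).mul (hE.continuousOn hdb.le)).mono hsub)
        (fun t ht => hup t (Ioo_subset_Icc_self ht)) hz)
    have h4 := lt_of_le_of_ne h2 h3.symm
    have h5 : (u x * w x - v x * u' x) * E x < 0 := by linarith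
    exact neg_of_mul_neg_left h5 (hEpos x).le
  have hsub : Icc d y ⊆ Icc d b := Icc_subset_Icc_right hy.2
  have hanti : StrictAntiOn (fun x => v x / u x) (Icc d y) := by
    refine strictAntiOn_of_deriv_neg (convex_Icc d y)
      (((hv.fst.continuousOn hdb.le).mono hsub).div ((hu.fst.continuousOn hdb.le).mono hsub)
        fun x hx => (hyp x hx).ne') fun x hx => ?_
    rw [interior_Icc] at hx
    have hxb : x ∈ Ioo d b := ⟨hx.1, hx.2.trans_le hy.2⟩
    have hux := hyp x (Ioo_subset_Icc_self hx)
    have h1 := (hv.fst.hasDerivAt_of_continuousOn (hv.snd.continuousOn hdb.le) hxb).div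
      (hu.fst.hasDerivAt_of_continuousOn (hu.snd.continuousOn hdb.le) hxb) hux.ne'
    have h2 : deriv (fun x => v x / u x) x = _ := h1.deriv
    rw [h2]
    refine div_neg_of_neg_of_pos ?_ (by positivity)
    linarith [hneg x hx]
  have h1 := hanti ⟨le_rfl, hy.1.le⟩ ⟨hy.1.le, le_rfl⟩ hy.1
  simp only [hvd, zero_div] at h1
  refine ⟨y, ⟨hy.1.le, hy.2⟩, ?_⟩
  have hyu := hyp y ⟨hy.1.le, le_rfl⟩
  rw [div_lt_iff₀ hyu] at h1
  linarith

theorem pos_of_exists_nonneg (hab : a < b) (hh : IntervalIntegrable h volume a b)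
    (h0 : ∀ x ∈ Icc a b, 0 ≤ h x) (hhpos : 0 < ∫ t in a..b, h t)
    (hφ₁ : IsCaratheodorySol p q (fun _ => 0) φ₁ φ₁' a b)
    (hφ₂ : IsCaratheodorySol p q (fun _ => 0) φ₂ φ₂' a b)
    (hE : IsPrimitiveOn E (fun t => q t * E t) a b) (hEa : E a = 1) (hEpos : ∀ x, 0 < E x)
    (h₁ : φ₁ a = 1) (h₂ : φ₂ a = 0) (h₂' : φ₂' a = 1)
    (hv : IsCaratheodorySol p q h v w a b) (hv0 : ∀ x ∈ Icc a b, 0 ≤ v x) :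
    ∀ x ∈ Ioc a b, 0 < φ₂ x := by
  by_contra! hcon
  obtain ⟨x₀, hx₀, hx₀le⟩ := hcon
  have hW {x : ℝ} (hx : x ∈ Icc a b) := wronskian_mul_eq_one hab.le hφ₁ hφ₂ hE hEa h₁ h₂ h₂' hx
  have hφ₂c := hφ₂.fst.continuousOn hab.le
  have hφ₂c' := hφ₂.snd.continuousOn hab.le
  obtain ⟨y, hy, hyp⟩ := hφ₂c'.exists_pos_on_Icc_right hab (by simp [h₂'])
  have hleft : ∀ x ∈ Ioc a y, 0 < φ₂ x := fun x hx => h₂ ▸ hφ₂.fst.lt_of_pos le_rfl hx.1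
    (hx.2.trans hy.2) fun t ht => hyp t ⟨ht.1.le, ht.2.le.trans hx.2⟩
  -- `c` is the first zero of `φ₂` to the right of `a`.
  obtain ⟨c, ⟨⟨hyc, hcb⟩, hφc⟩, hleast⟩ : ∃ c, IsLeast {x | x ∈ Icc y b ∧ φ₂ x ≤ 0} c := by
    refine IsCompact.exists_isLeast ?_ ⟨x₀, ⟨?_, hx₀.2⟩, hx₀le⟩
    · exact isCompact_Icc.of_isClosed_subset
        ((hφ₂c.mono (Icc_subset_Icc_left hy.1.le)).preimage_isClosed_of_isClosed isClosed_Icc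
          isClosed_Iic) fun x hx => hx.1
    · by_contra! hlt
      exact (hleft x₀ ⟨hx₀.1, hlt.le⟩).not_ge hx₀le
  have hac : a < c := hy.1.trans_le hyc
  have hcI : c ∈ Icc a b := ⟨hac.le, hcb⟩
  have hposc : ∀ x ∈ Ioo a c, 0 < φ₂ x := by
    intro x hx
    rcases le_total x y with hxy | hxy
    · exact hleft x ⟨hx.1, hxy⟩
    · by_contra! hle
      exact (hleast ⟨⟨hxy, hx.2.le.trans hcb⟩, hle⟩).not_gt hx.2
  have hφc0 : φ₂ c = 0 := by
    obtain ⟨z, hz, hz0⟩ := intermediate_value_Icc' hyc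
      (hφ₂c.mono (Icc_subset_Icc hy.1.le hcb)) ⟨hφc, (hleft y ⟨hy.1, le_rfl⟩).le⟩
    rwa [le_antisymm hz.2 (hleast ⟨⟨hz.1, hz.2.trans hcb⟩, hz0.le⟩)] at hz0
  have hφc' : φ₂' c < 0 := by
    refine lt_of_le_of_ne ?_ fun hz => ?_
    · by_contra! hgt
      obtain ⟨z, hz, hzp⟩ := (hφ₂c'.mono (Icc_subset_Icc_right hcb)).exists_pos_on_Icc_left hac hgt
      have h3 := hφ₂.fst.lt_of_pos hz.1 hz.2 hcb fun t ht => hzp t (Ioo_subset_Icc_self ht)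
      rcases hz.1.eq_or_lt with rfl | haz
      · linarith
      · linarith [hposc z ⟨haz, hz.2⟩]
    · have := hW hcI
      simp [hφc0, hz] at this
  have hsubc : Icc a c ⊆ Icc a b := Icc_subset_Icc_right hcb
  have hhc : IntervalIntegrable h volume a c :=
    hh.mono_set (by rwa [uIcc_of_le hac.le, uIcc_of_le hab.le])
  have hid := (wronskian_mul hab.le hφ₂ hv hE).eq_add_integral c hcI
  simp only [hφc0, h₂, h₂', hEa, intervalIntegral.integral_neg] at hid
  have hint0 : 0 ≤ ∫ t in a..c, h t * (φ₂ t * E t) := by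
    refine intervalIntegral.integral_nonneg hac.le fun t ht =>
      mul_nonneg (h0 t (hsubc ht)) (mul_nonneg ?_ (hEpos t).le)
    rcases ht.1.eq_or_lt with rfl | h3
    · exact h₂.ge
    rcases ht.2.eq_or_lt with rfl | h4
    · exact hφc0.ge
    exact (hposc t ⟨h3, h4⟩).le
  have hca : 0 ≤ v c * -φ₂' c * E c :=
    mul_nonneg (mul_nonneg (hv0 c hcI) (neg_nonneg.2 hφc'.le)) (hEpos c).le
  have hva := hv0 a ⟨le_rfl, hab.le⟩
  have hvc : v c = 0 := by
    have h3 : v c * -φ₂' c * E c = 0 := by linarith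
    simpa [hφc'.ne, (hEpos c).ne'] using h3
  have hHc : ∫ t in a..c, h t = 0 :=
    integral_eq_zero_of_integral_mul_eq_zero (P := fun t => φ₂ t * E t) hac.le hhc (fun t ht => h0 t (hsubc ht))
      ((hφ₂c.mul (hE.continuousOn hab.le)).mono hsubc)
      (fun t ht => mul_pos (hposc t ht) (hEpos t)) (by linarith)
  have hHP := hh.isPrimitiveOn 0
  -- `d` is the last point up to which `h` vanishes almost everywhere.
  obtain ⟨d, ⟨⟨hcd, hdb'⟩, hHd⟩, hgreatest⟩ :
      ∃ d, IsGreatest {x | x ∈ Icc c b ∧ 0 + ∫ t in a..x, h t = 0} d := by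
    refine IsCompact.exists_isGreatest ?_ ⟨c, ⟨le_rfl, hcb⟩, by simpa using hHc⟩
    exact isCompact_Icc.of_isClosed_subset
      (((hHP.continuousOn hab.le).mono (Icc_subset_Icc_left hac.le)).preimage_isClosed_of_isClosed
        isClosed_Icc (isClosed_singleton (x := 0))) fun x hx => hx.1
  have hdb : d < b := lt_of_le_of_ne hdb' fun hz => by
    rw [hz] at hHd; linarith
  have had : a < d := hac.trans_le hcd
  have hdI : d ∈ Icc a b := ⟨had.le, hdb'⟩
  have hwc : w c = 0 := by
    have hcI' : c ∈ Ioo a b := ⟨hac, hcd.trans_lt hdb⟩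
    refine IsLocalMin.hasDerivAt_eq_zero (f := v) (a := c) ?_
      (hv.fst.hasDerivAt_of_continuousOn (hv.snd.continuousOn hab.le) hcI')
    filter_upwards [Icc_mem_nhds hcI'.1 hcI'.2] with x hx
    rw [hvc]; exact hv0 x hx
  have hHcd : ∫ t in c..d, h t = 0 := by
    rw [hHP.integral_sub hcI hdI, hHd, hHc]; simp
  have hD : ∀ {u u' : ℝ → ℝ}, IsCaratheodorySol p q (fun _ => 0) u u' a b →
      u d * w d - v d * u' d = 0 := by
    intro u u' hu
    have h3 := (wronskian_mul hab.le hu hv hE).integral_sub hcI hdI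
    rw [intervalIntegral.integral_neg, integral_mul_eq_zero_of_integral_eq_zero hcd
      (hHP.mono hac.le hcd hdb').intervalIntegrable
      (fun t ht => h0 t ⟨hac.le.trans ht.1, ht.2.trans hdb'⟩) hHcd] at h3
    simpa [hvc, hwc, (hEpos d).ne'] using h3
  have hD₁ := hD hφ₁
  have hD₂ := hD hφ₂
  have hvd : v d = 0 := by linear_combination (φ₂ d * hD₁ - φ₁ d * hD₂) * E d - v d * hW hdI
  have hwd : w d = 0 := by linear_combination (φ₂' d * hD₁ - φ₁' d * hD₂) * E d - w d * hW hdI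
  have hη := hφ₁.linear_combination (h := fun _ => 0) hab.le hφ₂ (φ₂' d) (-φ₁' d)
    fun x => by ring
  obtain ⟨z, hz, hzneg⟩ := exists_neg_of_eq_zero hdb
    (hHP.mono had.le hdb' le_rfl).intervalIntegrable
    (fun t ht => h0 t ⟨had.le.trans ht.1, ht.2⟩)
    (fun x hx hz => (hgreatest ⟨⟨hcd.trans hx.1.le, hx.2⟩, by
      have := hHP.integral_sub hdI ⟨had.le.trans hx.1.le, hx.2⟩
      linarith⟩).not_gt hx.1)
    ⟨hη.fst.mono had.le hdb' le_rfl, hη.snd.mono had.le hdb' le_rfl⟩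
    (pos_of_mul_pos_left (b := E d) (by linarith [hW hdI]) (hEpos d).le)
    ⟨hv.fst.mono had.le hdb' le_rfl, hv.snd.mono had.le hdb' le_rfl⟩
    (hE.mono had.le hdb' le_rfl) hEpos hvd hwd
  exact (hv0 z ⟨had.le.trans hz.1, hz.2⟩).not_gt hzneg

end IsCaratheodorySol

/-- Existence of a non-negative (Carathéodory) solution of
r v − α v' − (σ²/2) v'' − g = 0 on [a,b] ⊂ I, for non-negative g with
∫ₐᵇ g/σ² > 0, is equivalent to φ₁₂(a,x) > 0 for all x ∈ (a,b]. -/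
theorem stmt_4
    (I : Set ℝ) (hI : IsOpen I) (hIconn : I.OrdConnected)
    (α r σ : ℝ → ℝ)
    (hmα : Measurable α) (hmr : Measurable r) (hmσ : Measurable σ)
    (hσpos : ∀ x ∈ I, 0 < σ x)
    (hint1 : MeasureTheory.LocallyIntegrableOn (fun z => 1 / (σ z) ^ 2) I)
    (hint2 : MeasureTheory.LocallyIntegrableOn (fun z => α z / (σ z) ^ 2) I)
    (hint3 : MeasureTheory.LocallyIntegrableOn (fun z => r z / (σ z) ^ 2) I)
    (φ11 φ12 φ21 φ22 : ℝ → ℝ → ℝ)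
    (hφ11 : ∀ x ∈ I, ∀ y ∈ I, φ11 x y = 1 + ∫ z in x..y, φ21 x z)
    (hφ12 : ∀ x ∈ I, ∀ y ∈ I, φ12 x y = ∫ z in x..y, φ22 x z)
    (hφ21 : ∀ x ∈ I, ∀ y ∈ I, φ21 x y =
      ∫ z in x..y, (2 * r z / (σ z) ^ 2 * φ11 x z - 2 * α z / (σ z) ^ 2 * φ21 x z))
    (hφ22 : ∀ x ∈ I, ∀ y ∈ I, φ22 x y = 1 +
      ∫ z in x..y, (2 * r z / (σ z) ^ 2 * φ12 x z - 2 * α z / (σ z) ^ 2 * φ22 x z))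
    (g : ℝ → ℝ) (hmg : Measurable g) (hg0 : ∀ x ∈ I, 0 ≤ g x)
    (hgint : MeasureTheory.LocallyIntegrableOn (fun z => g z / (σ z) ^ 2) I)
    (a b : ℝ) (ha : a ∈ I) (hb : b ∈ I) (hab : a < b)
    (hgpos : 0 < ∫ z in a..b, g z / (σ z) ^ 2) :
    (∃ v w : ℝ → ℝ,
      (∀ x ∈ Set.Icc a b, v x = v a + ∫ t in a..x, w t) ∧
      (∀ x ∈ Set.Icc a b, w x = w a +
        ∫ t in a..x, 2 / (σ t) ^ 2 * (r t * v t - α t * w t - g t)) ∧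
      (∀ x ∈ Set.Icc a b, 0 ≤ v x)) ↔
    (∀ x ∈ Set.Ioc a b, 0 < φ12 a x) := by
  have hsub : Icc a b ⊆ I := hIconn.out ha hb
  have hII : ∀ {f : ℝ → ℝ}, LocallyIntegrableOn f I → IntervalIntegrable f volume a b := fun hf => by
    rw [intervalIntegrable_iff_integrableOn_Icc_of_le hab.le]
    exact hf.integrableOn_compact_subset hsub isCompact_Icc
  set p : ℝ → ℝ := fun z => 2 * r z / (σ z) ^ 2 with hp
  set q : ℝ → ℝ := fun z => 2 * α z / (σ z) ^ 2 with hq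
  set h : ℝ → ℝ := fun z => 2 * (g z / (σ z) ^ 2) with hh
  have hpi : IntervalIntegrable p volume a b := by
    simpa only [hp, mul_div_assoc] using (hII hint3).const_mul 2
  have hqi : IntervalIntegrable q volume a b := by
    simpa only [hq, mul_div_assoc] using (hII hint2).const_mul 2
  have hhi : IntervalIntegrable h volume a b := (hII hgint).const_mul 2
  have h11 : φ11 a a = 1 := by simpa using hφ11 a ha a ha
  have h12 : φ12 a a = 0 := by simpa using hφ12 a ha a ha
  have h21 : φ21 a a = 0 := by simpa using hφ21 a ha a ha
  have h22 : φ22 a a = 1 := by simpa using hφ22 a ha a ha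
  have hzero : IntervalIntegrable (fun _ : ℝ => (0 : ℝ)) volume a b := intervalIntegrable_const
  have hΦ₁ : IsCaratheodorySol p q (fun _ => 0) (φ11 a) (φ21 a) a b :=
    .of_integral_eq hab.le hpi hqi hzero
      (fun x hx => by rw [h11]; exact hφ11 a ha x (hsub hx))
      (fun x hx => by simpa only [h21, zero_add, sub_zero] using hφ21 a ha x (hsub hx))
  have hΦ₂ : IsCaratheodorySol p q (fun _ => 0) (φ12 a) (φ22 a) a b :=
    .of_integral_eq hab.le hpi hqi hzero
      (fun x hx => by rw [h12, zero_add]; exact hφ12 a ha x (hsub hx))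
      (fun x hx => by simpa only [h22, sub_zero] using hφ22 a ha x (hsub hx))
  have hE := (hqi.isPrimitiveOn 0).exp hab.le
  have hrhs : ∀ v w : ℝ → ℝ, (fun t => 2 / (σ t) ^ 2 * (r t * v t - α t * w t - g t)) =
      fun t => p t * v t - q t * w t - h t := fun v w => by
    funext t; simp only [hp, hq, hh]; ring
  constructor
  · rintro ⟨v, w, hv, hw, hv0⟩
    simp only [hrhs v w] at hw
    refine IsCaratheodorySol.pos_of_exists_nonneg hab hhi (fun x hx => ?_) ?_ hΦ₁ hΦ₂ hE (by simp)
      (fun x => Real.exp_pos _) h11 h12 h22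
      (.of_integral_eq hab.le hpi hqi hhi hv hw) hv0
    · have := hg0 x (hsub hx)
      positivity
    · rw [intervalIntegral.integral_const_mul]
      positivity
  · intro hpos
    obtain ⟨v, w, hvw, hv0⟩ :=
      IsCaratheodorySol.exists_nonneg hab hhi hΦ₁ hΦ₂ hE (by simp) h11 h12 h22 hpos
    exact ⟨v, w, hvw.fst.eq_add_integral, by simpa only [hrhs v w] using hvw.snd.eq_add_integral,
      hv0⟩
end
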